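/- Let p ∈ [0,1/2] and r ∈ [0,1] be such that 1 − H₂(p) − r > 0, where H₂ is the binary entropy function. For every R < 1 − H₂(p) − r there exist R' ≥ 0, a positive integer k, a constant γ > 0, and for every δ > 0 an integer n₀, such that for all n ≥ n₀ (with Rn, R'n, rn, pn integers) there exists an [n,Rn,R'n] code C_n with (stochastic) encoder x : {0,1}^{Rn} × {0,1}^{R'n} → {0,1}^n satisfying both: (i) Sem(C_n) ≤ 2^{−γn}; and (ii) for every message m ∈ {0,1}^{Rn}, every set S ⊆ {1,…,n} with |S| = rn, and every adversarial error map e : {0,1}^{rn} → {0,1}^n assigning to each observation an error vector of Hamming weight at most pn, the probability (over W uniform on {0,1}^{R'n}) that minimum-distance decoding of x(m,W) + e(x(m,W,S)) returns a message different from m is at most δ. Moreover C_n can be taken pseudolinear: x(m,w) = h(m,w)·G_n for a matrix G_n ∈ GF(2)^{ℓ×n} with ℓ = O(k(R+R')n) and a map h : {0,1}^{Rn} × {0,1}^{R'n} → GF(2)^ℓ whose images of distinct nonzero inputs are distinct nonzero vectors, any k of which are linearly independent over GF(2). -/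

import Mathlib

open Finset
open scoped Classical

/-- Binary entropy function (base-2 logarithms). -/
noncomputable def H2 (x : ℝ) : ℝ := -(x * Real.logb 2 x) - (1 - x) * Real.logb 2 (1 - x)

/-- Base-2 mutual information of a finite joint distribution `P` on `M × Z`
(marginals are computed from the joint). -/
noncomputable def mutualInfo {M Z : Type*} [Fintype M] [Fintype Z]
    (P : M → Z → ℝ) : ℝ :=
  ∑ m, ∑ z, P m z * Real.logb 2 (P m z / ((∑ z', P m z') * (∑ m', P m' z)))

/-- Semantic leakage of a stochastic code with encoder `x : M → W → {0,1}ⁿ` against an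
adversary reading `s` coordinates. -/
noncomputable def semLeak {n : ℕ} {M W : Type*} [Fintype M] [Fintype W]
    (s : ℕ) (x : M → W → Fin n → ZMod 2) : ℝ :=
  sSup { I : ℝ | ∃ (PM : M → ℝ) (S : Finset (Fin n)),
    (∀ m, 0 ≤ PM m) ∧ (∑ m, PM m = 1) ∧ S.card = s ∧
    I = mutualInfo (fun m (z : {i : Fin n // i ∈ S} → ZMod 2) =>
      PM m * (((Finset.univ.filter (fun w : W =>
        (fun i : {i : Fin n // i ∈ S} => x m w i.val) = z)).card : ℝ)
        / (Fintype.card W : ℝ))) }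

/-- The number of elements of `α` satisfying `P`. -/
noncomputable def numOf {α : Type} [Fintype α] (P : α → Prop) : ℕ := (univ.filter P).card

theorem numOf_eq_card {α : Type} [Fintype α] (P : α → Prop) [DecidablePred P] :
    numOf P = (univ.filter P).card := by
  unfold numOf
  congr!

/-- The family `X ω : Q → V`, for `ω` uniform on `Ω`, is `k`-wise independent and uniform. -/
def KWiseUniform {Ω Q V : Type} [Fintype Ω] [Fintype V] (X : Ω → Q → V) (k : ℕ) : Prop :=
  ∀ (ι : Type) [Fintype ι] (q : ι → Q), Function.Injective q → Fintype.card ι ≤ k →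
    ∀ y : ι → V, (univ.filter fun ω => (fun i => X ω (q i)) = y).card
      * Fintype.card V ^ Fintype.card ι = Fintype.card Ω

namespace KWiseUniform

variable {Ω Q V : Type} [Fintype Ω] [Fintype V] {X : Ω → Q → V} {k : ℕ}

theorem comp (hX : KWiseUniform X k) {Q' : Type} (f : Q' → Q) (hf : Function.Injective f) :
    KWiseUniform (fun ω q => X ω (f q)) k :=
  fun ι _ q hq hk y => hX ι (f ∘ q) (hf.comp hq) hk y

theorem sum_eq [Nonempty V] (hX : KWiseUniform X k) (ι : Type) [Fintype ι] (q : ι → Q)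
    (hq : Function.Injective q) (hk : Fintype.card ι ≤ k) (F : (ι → V) → ℝ) :
    (∑ ω, F (fun i => X ω (q i))) * (Fintype.card V : ℝ) ^ Fintype.card ι
      = Fintype.card Ω * ∑ y, F y := by
  have h1 : ∑ ω, F (fun i => X ω (q i))
      = ∑ y, ((univ.filter fun ω => (fun i => X ω (q i)) = y).card : ℝ) * F y := by
    rw [← Finset.sum_fiberwise (s := univ) (g := fun ω => (fun i => X ω (q i)))]
    refine sum_congr rfl fun y _ => ?_
    rw [sum_congr rfl (g := fun _ => F y), sum_const, nsmul_eq_mul]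
    intro ω hω
    rw [(mem_filter.1 hω).2]
  rw [h1, sum_mul, mul_sum]
  refine sum_congr rfl fun y _ => ?_
  rw [← hX ι q hq hk y]
  push_cast
  ring

theorem card_event [Nonempty V] (hX : KWiseUniform X k) (ι : Type) [Fintype ι] (q : ι → Q)
    (hq : Function.Injective q) (hk : Fintype.card ι ≤ k) (E : (ι → V) → Prop) :
    ((numOf fun ω => E (fun i => X ω (q i))) : ℝ)
        * (Fintype.card V : ℝ) ^ Fintype.card ι
      = Fintype.card Ω * (numOf E) := by
  have := hX.sum_eq ι q hq hk (fun y => if E y then 1 else 0)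
  rw [numOf_eq_card, numOf_eq_card]
  simpa using this

theorem sum_prod_le [Nonempty V] (hX : KWiseUniform X k) (T : Finset Q) (hk : T.card ≤ k)
    (F : Q → V → ℝ) (B : ℝ)
    (hF : |∏ q ∈ T, ∑ v, F q v| ≤ (B * Fintype.card V) ^ T.card) :
    ∑ ω, ∏ q ∈ T, F q (X ω q) ≤ Fintype.card Ω * B ^ T.card := by
  have hV : (0 : ℝ) < (Fintype.card V : ℝ) ^ T.card := by
    have : 0 < Fintype.card V := Fintype.card_pos
    positivity
  have h := hX.sum_eq T (fun q => q.1) Subtype.val_injective (by simpa using hk)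
    (fun y => ∏ q : T, F q (y q))
  have h2 : ∑ y : T → V, ∏ q : T, F q (y q) = ∏ q ∈ T, ∑ v, F q v := by
    rw [← Finset.prod_coe_sort T (fun q => ∑ v, F q v), Finset.prod_univ_sum]
    simp
  simp only [Fintype.card_coe] at h
  replace h := h.trans (congrArg _ (Eq.trans (by congr!) h2))
  have h3 : ∀ ω, ∏ q : T, F q (X ω q) = ∏ q ∈ T, F q (X ω q) := fun ω =>
    Finset.prod_coe_sort T (fun q => F q (X ω q))
  simp only [h3] at h
  refine le_of_mul_le_mul_right ?_ hV
  rw [h, mul_assoc, ← mul_pow]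
  exact mul_le_mul_of_nonneg_left ((le_abs_self _).trans hF) (Nat.cast_nonneg _)

end KWiseUniform

theorem card_tuples_card_image_eq_le {Q : Type} [Fintype Q] (l j : ℕ) :
    (univ.filter fun t : Fin l → Q => (univ.image t).card = j).card
      ≤ j ^ l * Fintype.card Q ^ j := by
  have : (univ.filter fun t : Fin l → Q => (univ.image t).card = j)
      ⊆ (univ : Finset ((Fin l → Fin j) × (Fin j → Q))).image (fun c => c.2 ∘ c.1) := by
    intro t ht
    have hj := (mem_filter.1 ht).2
    let eqv := (univ.image t).equivFinOfCardEq hj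
    refine mem_image.2 ⟨(fun i => eqv ⟨t i, mem_image_of_mem _ (mem_univ _)⟩,
      fun i => (eqv.symm i).1), mem_univ _, ?_⟩
    funext i
    simp
  refine (card_le_card this).trans (card_image_le.trans ?_)
  simp [Fintype.card_prod]

namespace KWiseUniform

theorem moment_le {Ω Q V : Type} [Fintype Ω] [Fintype Q] [Fintype V] [Nonempty V]
    {X : Ω → Q → V} {h : ℕ} (hX : KWiseUniform X (2 * h)) (g : V → ℝ)
    (hg1 : ∀ v, |g v| ≤ 1) (hg0 : ∑ v, g v = 0) {σ : ℝ} (hσ : 0 ≤ σ)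
    (hg2 : ∑ v, g v ^ 2 ≤ σ * Fintype.card V) {M : ℝ} (hM1 : 1 ≤ M)
    (hM : Fintype.card Q * σ ≤ M) :
    ∑ ω, (∑ q, g (X ω q)) ^ (2 * h)
      ≤ Fintype.card Ω * ((h + 1) * (h : ℝ) ^ (2 * h) * M ^ h) := by
  have key : ∀ t : Fin (2 * h) → Q, ∑ ω, ∏ i, g (X ω (t i))
      ≤ if (univ.image t).card ≤ h then Fintype.card Ω * σ ^ (univ.image t).card else 0 := by
    intro t
    set mult : Q → ℕ := fun q => (univ.filter fun i => t i = q).card with hmult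
    have hprod : ∀ ω, ∏ i, g (X ω (t i))
        = ∏ q ∈ univ.image t, g (X ω q) ^ mult q := fun ω =>
      Finset.prod_comp (fun q => g (X ω q)) t
    simp only [hprod]
    have hcard : ∑ q ∈ univ.image t, mult q = 2 * h := by
      have := Finset.card_eq_sum_card_image t univ
      simpa [hmult] using this.symm
    have hpos : ∀ q ∈ univ.image t, 1 ≤ mult q := by
      intro q hq
      obtain ⟨i, -, rfl⟩ := mem_image.1 hq
      exact card_pos.2 ⟨i, by simp⟩
    have hT : (univ.image t).card ≤ 2 * h := by
      refine le_trans ?_ hcard.le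
      rw [card_eq_sum_ones]
      exact sum_le_sum hpos
    by_cases h1 : ∃ q ∈ univ.image t, mult q = 1
    · obtain ⟨q, hq, hq1⟩ := h1
      have hz : ∏ q ∈ univ.image t, ∑ v, g v ^ mult q = 0 :=
        prod_eq_zero hq (by simpa [hq1] using hg0)
      have := hX.sum_prod_le (univ.image t) hT (fun q v => g v ^ mult q) 0 (by
        rw [hz]; simp)
      refine this.trans ?_
      have hne : (univ.image t).card ≠ 0 := card_ne_zero_of_mem hq
      rw [zero_pow hne, mul_zero]
      split_ifs <;> positivity
    · push Not at h1
      have h2 : ∀ q ∈ univ.image t, 2 ≤ mult q := fun q hq => by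
        have := hpos q hq
        have := h1 q hq
        omega
      have hle : (univ.image t).card ≤ h := by
        have : (univ.image t).card * 2 ≤ ∑ q ∈ univ.image t, mult q := by
          rw [← smul_eq_mul]
          exact card_nsmul_le_sum _ _ _ h2
        omega
      rw [if_pos hle]
      refine hX.sum_prod_le (univ.image t) hT (fun q v => g v ^ mult q) σ ?_
      rw [abs_prod, ← prod_const]
      refine prod_le_prod (fun q _ => abs_nonneg _) fun q hq => ?_
      refine (abs_sum_le_sum_abs _ _).trans (le_trans (sum_le_sum fun v _ => ?_) hg2)
      rw [abs_pow, ← sq_abs (g v)]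
      exact pow_le_pow_of_le_one (abs_nonneg _) (hg1 v) (h2 q hq)
  have expand : ∑ ω, (∑ q, g (X ω q)) ^ (2 * h)
      = ∑ t : Fin (2 * h) → Q, ∑ ω, ∏ i, g (X ω (t i)) := by
    rw [sum_comm]
    refine sum_congr rfl fun ω _ => ?_
    rw [Fintype.sum_pow]
  rw [expand]
  refine (sum_le_sum fun t _ => key t).trans ?_
  rw [← sum_filter]
  have hmaps : ∀ t ∈ univ.filter (fun t : Fin (2 * h) → Q => (univ.image t).card ≤ h),
      (univ.image t).card ∈ range (h + 1) := fun t ht => by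
    have := (mem_filter.1 ht).2
    exact mem_range.2 (by omega)
  rw [← sum_fiberwise_of_maps_to hmaps]
  have hj : ∀ j ∈ range (h + 1),
      ∑ t ∈ (univ.filter (fun t : Fin (2 * h) → Q => (univ.image t).card ≤ h)).filter
        (fun t => (univ.image t).card = j), (Fintype.card Ω : ℝ) * σ ^ (univ.image t).card
      ≤ Fintype.card Ω * ((h : ℝ) ^ (2 * h) * M ^ h) := by
    intro j hj
    have hjh : j ≤ h := by have := mem_range.1 hj; omega
    rw [sum_congr rfl (g := fun _ => (Fintype.card Ω : ℝ) * σ ^ j)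
      (fun t ht => by rw [(mem_filter.1 ht).2]), sum_const, nsmul_eq_mul]
    have hc : (((univ.filter (fun t : Fin (2 * h) → Q => (univ.image t).card ≤ h)).filter
        (fun t => (univ.image t).card = j)).card : ℝ) ≤ (j : ℝ) ^ (2 * h) * Fintype.card Q ^ j := by
      have := (card_le_card (filter_subset_filter (fun t => (univ.image t).card = j)
        (filter_subset (fun t : Fin (2 * h) → Q => (univ.image t).card ≤ h) univ))).trans
        (card_tuples_card_image_eq_le (Q := Q) (2 * h) j)
      exact_mod_cast this
    calc _ ≤ ((j : ℝ) ^ (2 * h) * Fintype.card Q ^ j) * (Fintype.card Ω * σ ^ j) := by gcongr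
      _ = Fintype.card Ω * ((j : ℝ) ^ (2 * h) * (Fintype.card Q * σ) ^ j) := by
        rw [mul_pow]; ring
      _ ≤ Fintype.card Ω * ((h : ℝ) ^ (2 * h) * M ^ h) := by
        have : (Fintype.card Q * σ) ^ j ≤ M ^ h :=
          (pow_le_pow_left₀ (by positivity) hM j).trans (pow_le_pow_right₀ hM1 hjh)
        gcongr
  refine (sum_le_sum hj).trans (le_of_eq ?_)
  rw [sum_const, card_range, nsmul_eq_mul]
  push_cast
  ring

theorem card_deviation_le {Ω Q V : Type} [Fintype Ω] [Fintype Q] [Fintype V] [Nonempty V]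
    {X : Ω → Q → V} {h : ℕ} (hX : KWiseUniform X (2 * h)) (A : V → Prop) {σ M η : ℝ}
    (hA : ((numOf A) : ℝ) = σ * Fintype.card V) (hM1 : 1 ≤ M)
    (hM : Fintype.card Q * σ = M) (hη : 0 < η) :
    ((numOf fun ω => η * M < |((numOf fun q => A (X ω q)) : ℝ) - M|) : ℝ)
      * (η ^ (2 * h) * M ^ h) ≤ Fintype.card Ω * ((h + 1) * (h : ℝ) ^ (2 * h)) := by
  have hV : (0 : ℝ) < Fintype.card V := by exact_mod_cast Fintype.card_pos
  have hσ0 : 0 ≤ σ := by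
    by_contra hneg
    have : σ * Fintype.card V < 0 := mul_neg_of_neg_of_pos (not_le.1 hneg) hV
    have h0 : (0 : ℝ) ≤ (numOf A) := Nat.cast_nonneg _
    linarith
  have hσ1 : σ ≤ 1 := by
    have : ((numOf A) : ℝ) ≤ Fintype.card V := by
      rw [numOf]
      exact_mod_cast card_le_univ _
    rw [hA] at this
    exact le_of_mul_le_mul_right (by linarith) hV
  set g : V → ℝ := fun v => (if A v then 1 else 0) - σ with hg
  have hg1 : ∀ v, |g v| ≤ 1 := by
    intro v
    simp only [hg]
    rw [abs_le]
    split_ifs <;> constructor <;> linarith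
  have hg0 : ∑ v, g v = 0 := by
    simp only [hg, sum_sub_distrib, sum_boole, sum_const, card_univ, nsmul_eq_mul]
    rw [← numOf_eq_card, hA]; ring
  have hg2 : ∑ v, g v ^ 2 ≤ σ * Fintype.card V := by
    have : ∀ v, g v ^ 2 = (1 - 2 * σ) * (if A v then 1 else 0) + σ ^ 2 := by
      intro v
      simp only [hg]
      split_ifs <;> ring
    simp only [this, sum_add_distrib, ← mul_sum, sum_boole, sum_const, card_univ, nsmul_eq_mul]
    rw [← numOf_eq_card, hA]
    nlinarith [mul_nonneg (sq_nonneg σ) hV.le]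
  have hmom := hX.moment_le g hg1 hg0 hσ0 hg2 hM1 hM.le
  have hsum : ∀ ω, ∑ q, g (X ω q) = ((numOf fun q => A (X ω q)) : ℝ) - M := by
    intro ω
    simp only [hg, sum_sub_distrib, sum_boole, sum_const, card_univ, nsmul_eq_mul]
    rw [hM, numOf_eq_card]
  simp only [hsum] at hmom
  have hM0 : 0 < M := by linarith
  have hmarkov : ((numOf fun ω =>
      η * M < |((numOf fun q => A (X ω q)) : ℝ) - M|) : ℝ) * (η * M) ^ (2 * h)
      ≤ ∑ ω, (((numOf fun q => A (X ω q)) : ℝ) - M) ^ (2 * h) := by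
    rw [← nsmul_eq_mul, numOf]
    refine (card_nsmul_le_sum _ (fun ω =>
      (((numOf fun q => A (X ω q)) : ℝ) - M) ^ (2 * h)) _ fun ω hω => ?_).trans
      (sum_le_sum_of_subset_of_nonneg (subset_univ _) fun ω _ _ => ?_)
    · have := (mem_filter.1 hω).2
      rw [← (even_two_mul h).pow_abs (_ - M)]
      exact pow_le_pow_left₀ (by positivity) this.le _
    · exact (even_two_mul h).pow_nonneg _
  refine le_of_mul_le_mul_right ?_ (pow_pos hM0 h)
  refine le_trans (le_of_eq ?_) ((hmarkov.trans hmom).trans (le_of_eq ?_))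
  · rw [mul_pow, show M ^ (2 * h) = M ^ h * M ^ h by rw [two_mul, pow_add]]; ring
  · ring

end KWiseUniform

theorem card_filter_card_le (Q : Type) [Fintype Q] (k : ℕ) :
    (univ.filter fun T : Finset Q => T.card ≤ k).card ≤ (Fintype.card Q + 1) ^ k := by
  induction k with
  | zero =>
    have : (univ.filter fun T : Finset Q => T.card ≤ 0) = {∅} := by
      ext T; simp
    rw [this]; simp
  | succ k ih =>
    have hsub : (univ.filter fun T : Finset Q => T.card ≤ k + 1)
        ⊆ ((univ : Finset (Option Q)) ×ˢ (univ.filter fun T : Finset Q => T.card ≤ k)).image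
          (fun c => c.1.elim c.2 (fun q => insert q c.2)) := by
      intro T hT
      have hT := (mem_filter.1 hT).2
      refine mem_image.2 ?_
      rcases T.eq_empty_or_nonempty with rfl | ⟨q, hq⟩
      · exact ⟨(none, ∅), by simp, rfl⟩
      · refine ⟨(some q, T.erase q), ?_, insert_erase hq⟩
        simp [card_erase_of_mem hq]
        omega
    refine (card_le_card hsub).trans (card_image_le.trans ?_)
    rw [card_product, card_univ, Fintype.card_option, pow_succ, mul_comm]
    gcongr

theorem linearIndependent_zmod_two_of_sum_ne_zero {κ E : Type} [AddCommGroup E]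
    [Module (ZMod 2) E] (v : κ → E) (hv : ∀ T : Finset κ, T.Nonempty → ∑ q ∈ T, v q ≠ 0) :
    LinearIndependent (ZMod 2) v := by
  rw [linearIndependent_iff']
  intro s g hg i hi
  by_contra hne
  refine hv (s.filter fun q => g q ≠ 0) ⟨i, mem_filter.2 ⟨hi, hne⟩⟩ ?_
  rw [sum_filter]
  refine Eq.trans (sum_congr rfl fun q _ => ?_) hg
  have h2 : ∀ c : ZMod 2, c ≠ 0 → c = 1 := by decide
  by_cases h0 : g q = 0
  · simp [h0]
  · rw [if_pos h0, h2 _ h0, one_smul]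

/-- A greedy (Gilbert–Varshamov) choice of vectors any `k` of which are independent. -/
theorem exists_linearIndependent_of_card_le (Q : Type) [Fintype Q] (k l : ℕ)
    (hkl : (Fintype.card Q + 1) ^ k < 2 ^ l) :
    ∃ h : Q → Fin l → ZMod 2, ∀ T : Finset Q, T.card ≤ k →
      LinearIndependent (ZMod 2) (fun q : T => h q.val) := by
  suffices H : ∀ s : Finset Q, ∃ h : Q → Fin l → ZMod 2,
      ∀ T ⊆ s, T.Nonempty → T.card ≤ k → ∑ q ∈ T, h q ≠ 0 by
    obtain ⟨h, hh⟩ := H univ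
    refine ⟨h, fun T hT => linearIndependent_zmod_two_of_sum_ne_zero _ fun T' hT' => ?_⟩
    have := hh (T'.map (Function.Embedding.subtype _)) (subset_univ _) (by simpa using hT')
      (by rw [card_map]; exact (card_le_univ _).trans (by simpa using hT))
    simpa using this
  intro s
  induction s using Finset.induction_on with
  | empty =>
    refine ⟨fun _ => 0, fun T hT hne => ?_⟩
    exact absurd (subset_empty.1 hT) hne.ne_empty
  | insert x s hx ih =>
    obtain ⟨h, hh⟩ := ih
    obtain ⟨v, hv⟩ : ∃ v : Fin l → ZMod 2, v ∉ (univ.filter fun T : Finset Q => T.card ≤ k).image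
        (fun T => ∑ q ∈ T, h q) := by
      by_contra! hall
      have h1 : Fintype.card (Fin l → ZMod 2) ≤ (Fintype.card Q + 1) ^ k := by
        rw [← card_univ]
        exact (card_le_card fun v _ => hall v).trans
          (card_image_le.trans (card_filter_card_le Q k))
      simp only [Fintype.card_pi, ZMod.card, prod_const, card_univ, Fintype.card_fin] at h1
      omega
    refine ⟨Function.update h x v, fun T hT hne hk => ?_⟩
    by_cases hxT : x ∈ T
    · rw [← add_sum_erase _ _ hxT, Function.update_self,
        sum_congr rfl (g := h) fun q hq => Function.update_of_ne (ne_of_mem_erase hq) _ _]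
      intro h0
      refine hv (mem_image.2 ⟨T.erase x, mem_filter.2 ⟨mem_univ _,
        (card_erase_le).trans hk⟩, ?_⟩)
      have hneg := eq_neg_of_add_eq_zero_left h0
      rw [hneg]
      funext i
      exact (ZMod.neg_eq_self_mod_two _).symm
    · rw [sum_congr rfl (g := h) fun q hq => Function.update_of_ne
        (ne_of_mem_of_not_mem hq hxT) _ _]
      exact hh T (fun q hq => (mem_insert.1 (hT hq)).resolve_left
        (ne_of_mem_of_not_mem hq hxT)) hne hk

theorem exists_linearMap_of_linearIndependent {K E F ι : Type} [Field K] [AddCommGroup E]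
    [AddCommGroup F] [Module K E] [Module K F] {v : ι → E} (hv : LinearIndependent K v)
    (z : ι → F) : ∃ g : E →ₗ[K] F, ∀ i, g (v i) = z i := by
  obtain ⟨g, hg⟩ := LinearMap.exists_extend ((Module.Basis.span hv).constr K z)
  refine ⟨g, fun i => ?_⟩
  have h1 := (Module.Basis.span hv).constr_basis K z i
  rw [← hg, LinearMap.comp_apply, Submodule.subtype_apply, Module.Basis.span_apply] at h1
  exact h1

theorem card_fiber_mul_card_of_surjective {A B : Type} [AddGroup A] [AddGroup B] [Fintype A]
    [Fintype B] (Φ : A →+ B) (hΦ : Function.Surjective Φ) (y : B) :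
    (univ.filter fun x => Φ x = y).card * Fintype.card B = Fintype.card A := by
  have hfib : ∀ z, (univ.filter fun x => Φ x = z).card = (univ.filter fun x => Φ x = y).card :=
    fun z => AddMonoidHom.card_fiber_eq_of_mem_range Φ (hΦ z) (hΦ y)
  have htot := card_eq_sum_card_fiberwise (f := Φ) (s := univ) (t := univ)
    (fun _ _ => mem_coe.2 (mem_univ _))
  rw [sum_congr rfl fun z _ => hfib z, sum_const, card_univ, card_univ, smul_eq_mul] at htot
  rw [htot, mul_comm]

/-- Multiplying `k`-wise linearly independent vectors by a uniform matrix gives a `k`-wise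
independent uniform family. -/
theorem kWiseUniform_vecMul {Q : Type} {k l n : ℕ} (h : Q → Fin l → ZMod 2)
    (hh : ∀ T : Finset Q, T.card ≤ k → LinearIndependent (ZMod 2) (fun q : T => h q.val)) :
    KWiseUniform (fun (G : Matrix (Fin l) (Fin n) (ZMod 2)) q => Matrix.vecMul (h q) G) k := by
  intro ι _ q hq hk y
  have hli : LinearIndependent (ZMod 2) (fun i => h (q i)) := by
    have h1 := hh (univ.image q) (card_image_le.trans hk)
    exact h1.comp (fun i => ⟨q i, mem_image_of_mem _ (mem_univ i)⟩)
      (fun i j hij => hq (congrArg Subtype.val hij))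
  let Φ : Matrix (Fin l) (Fin n) (ZMod 2) →+ (ι → Fin n → ZMod 2) :=
    { toFun := fun G i => Matrix.vecMul (h (q i)) G
      map_zero' := by funext i; simp
      map_add' := fun A B => by funext i; simp [Matrix.vecMul_add] }
  have hsurj : Function.Surjective Φ := by
    intro z
    obtain ⟨g, hg⟩ := exists_linearMap_of_linearIndependent hli z
    refine ⟨(LinearMap.toMatrix' g).transpose, ?_⟩
    funext i
    change Matrix.vecMul (h (q i)) _ = z i
    rw [Matrix.vecMul_transpose, LinearMap.toMatrix'_mulVec, hg]
  have := card_fiber_mul_card_of_surjective Φ hsurj y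
  have hc : Fintype.card (ι → Fin n → ZMod 2) = Fintype.card (Fin n → ZMod 2) ^ Fintype.card ι :=
    Fintype.card_fun
  rw [← hc, ← this]
  congr!

theorem prod_ite_eq_pow_hammingDist {n : ℕ} (p : ℝ) (v c : Fin n → ZMod 2) :
    ∏ i, (if v i = c i then 1 - p else p)
      = p ^ hammingDist v c * (1 - p) ^ (n - hammingDist v c) := by
  rw [prod_ite, prod_const, prod_const, mul_comm]
  have h1 : (univ.filter fun i => ¬ v i = c i).card = hammingDist v c := by
    simp [hammingDist]
  have h2 := card_filter_add_card_filter_not (s := univ) (fun i => v i = c i)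
  rw [h1, card_univ, Fintype.card_fin] at h2
  rw [h1]
  congr 2
  omega

theorem card_hammingBall_mul_le {n t : ℕ} (ht : t ≤ n) {p : ℝ} (hp0 : 0 ≤ p) (hp1 : p ≤ 1 / 2)
    (c : Fin n → ZMod 2) :
    ((numOf fun v : Fin n → ZMod 2 => hammingDist v c ≤ t) : ℝ)
      * (p ^ t * (1 - p) ^ (n - t)) ≤ 1 := by
  have hone : ∑ v : Fin n → ZMod 2, ∏ i, (if v i = c i then 1 - p else p) = 1 := by
    have := (Finset.prod_univ_sum (fun _ : Fin n => (univ : Finset (ZMod 2)))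
      (fun i x => if x = c i then 1 - p else p)).symm
    rw [Fintype.piFinset_univ] at this
    rw [this]
    refine prod_eq_one fun i _ => ?_
    have h2 : ∀ x : ZMod 2, ∑ y : ZMod 2, (if y = x then 1 - p else p) = 1 := by
      intro x
      have hx : x = 0 ∨ x = 1 := by revert x; decide
      have hu : (univ : Finset (ZMod 2)) = {0, 1} := by decide
      rw [hu, sum_pair (by decide)]
      rcases hx with rfl | rfl <;> simp
    exact h2 (c i)
  set f : (Fin n → ZMod 2) → ℝ := fun v => ∏ i, (if v i = c i then 1 - p else p) with hf
  have hf0 : ∀ v, 0 ≤ f v := fun v => prod_nonneg fun i _ => by split_ifs <;> linarith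
  have hball : ∀ v ∈ univ.filter fun v : Fin n → ZMod 2 => hammingDist v c ≤ t,
      p ^ t * (1 - p) ^ (n - t) ≤ f v := by
    intro v hv
    have hv := (mem_filter.1 hv).2
    rw [hf]
    simp only [prod_ite_eq_pow_hammingDist]
    obtain ⟨d, rfl⟩ := Nat.exists_eq_add_of_le hv
    have h3 : n - hammingDist v c = (n - (hammingDist v c + d)) + d := by omega
    rw [h3, pow_add, pow_add _ _ d]
    have : p ^ d ≤ (1 - p) ^ d := pow_le_pow_left₀ hp0 (by linarith) d
    have h4 : 0 ≤ p ^ hammingDist v c := by positivity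
    have h5 : 0 ≤ (1 - p) ^ (n - (hammingDist v c + d)) := pow_nonneg (by linarith) _
    nlinarith [mul_le_mul_of_nonneg_left this (mul_nonneg h4 h5)]
  have h1 := card_nsmul_le_sum _ f _ hball
  rw [← numOf_eq_card] at h1
  rw [nsmul_eq_mul] at h1
  have h2 := sum_le_sum_of_subset_of_nonneg
    (subset_univ (univ.filter fun v : Fin n → ZMod 2 => hammingDist v c ≤ t))
    fun v _ _ => hf0 v
  linarith

theorem rpow_neg_H2_mul {n t : ℕ} (htn : t ≤ n) {p : ℝ} (hp0 : 0 ≤ p) (hp1 : p ≤ 1 / 2)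
    (ht : (t : ℝ) = p * n) :
    (2 : ℝ) ^ (-(H2 p * n)) = p ^ t * (1 - p) ^ (n - t) := by
  rcases hp0.eq_or_lt with rfl | hp
  · have : t = 0 := by
      have : (t : ℝ) = 0 := by rw [ht]; ring
      exact_mod_cast this
    simp [this, H2]
  · have hq : 0 < 1 - p := by linarith
    have e1 : (2 : ℝ) ^ Real.logb 2 p = p := Real.rpow_logb (by norm_num) (by norm_num) hp
    have e2 : (2 : ℝ) ^ Real.logb 2 (1 - p) = 1 - p :=
      Real.rpow_logb (by norm_num) (by norm_num) hq
    have : -(H2 p * n) = Real.logb 2 p * t + Real.logb 2 (1 - p) * ((n - t : ℕ) : ℝ) := by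
      rw [Nat.cast_sub htn, ht, H2]; ring
    rw [this, Real.rpow_add (by norm_num), Real.rpow_mul (by norm_num), e1,
      Real.rpow_mul (by norm_num), e2, Real.rpow_natCast, Real.rpow_natCast]

theorem card_hammingBall_le {n t : ℕ} {p : ℝ} (hp0 : 0 ≤ p) (hp1 : p ≤ 1 / 2)
    (ht : (t : ℝ) = p * n) (c : Fin n → ZMod 2) :
    ((numOf fun v : Fin n → ZMod 2 => hammingDist v c ≤ t) : ℝ)
      ≤ (2 : ℝ) ^ (H2 p * n) := by
  have htn : t ≤ n := by
    have : (t : ℝ) ≤ n := by rw [ht]; nlinarith [(Nat.cast_nonneg n : (0 : ℝ) ≤ n)]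
    exact_mod_cast this
  have h1 := card_hammingBall_mul_le htn hp0 hp1 c
  rw [← rpow_neg_H2_mul htn hp0 hp1 ht, Real.rpow_neg (by norm_num), ← div_eq_mul_inv,
    div_le_one (by positivity)] at h1
  exact h1

theorem numOf_false {α : Type} [Fintype α] : numOf (fun _ : α => False) = 0 := by
  simp [numOf]

theorem card_filter_exists_le {Ω I : Type} [Fintype Ω] [Fintype I] (P : I → Ω → Prop) {c : ℝ}
    (h : ∀ i, ((numOf fun ω => P i ω) : ℝ) ≤ c) :
    ((numOf fun ω => ∃ i, P i ω) : ℝ) ≤ Fintype.card I * c := by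
  have hsub : (univ.filter fun ω => ∃ i, P i ω)
      ⊆ (univ : Finset I).biUnion fun i => univ.filter fun ω => P i ω := by
    intro ω hω
    obtain ⟨i, hi⟩ := (mem_filter.1 hω).2
    exact mem_biUnion.2 ⟨i, mem_univ _, mem_filter.2 ⟨mem_univ _, hi⟩⟩
  have h1 : ((numOf fun ω => ∃ i, P i ω) : ℝ)
      ≤ ∑ i : I, ((numOf fun ω => P i ω) : ℝ) := by
    rw [← Nat.cast_sum, Nat.cast_le, numOf_eq_card]
    exact (card_le_card hsub).trans (card_biUnion_le.trans
      (sum_le_sum fun i _ => (numOf_eq_card _).ge))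
  refine h1.trans ((sum_le_sum fun i _ => h i).trans (le_of_eq ?_))
  rw [sum_const, card_univ, nsmul_eq_mul]

theorem card_vec (n : ℕ) : (Fintype.card (Fin n → ZMod 2) : ℝ) = 2 ^ n := by
  simp [ZMod.card]

theorem card_agree_on {n : ℕ} (S : Finset (Fin n)) (z : Fin n → ZMod 2) :
    (numOf fun v : Fin n → ZMod 2 => ∀ i ∈ S, v i = z i) = 2 ^ (n - S.card) := by
  have : (univ.filter fun v : Fin n → ZMod 2 => ∀ i ∈ S, v i = z i)
      = Fintype.piFinset fun i => if i ∈ S then {z i} else univ := by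
    ext v
    simp only [mem_filter, mem_univ, true_and, Fintype.mem_piFinset]
    refine forall_congr' fun i => ?_
    split_ifs with hi <;> simp [hi]
  rw [numOf_eq_card, this, Fintype.card_piFinset]
  have h2 : ∀ i, (if i ∈ S then ({z i} : Finset (ZMod 2)) else univ).card
      = if i ∈ S then 1 else 2 := by
    intro i
    split_ifs
    · simp
    · simp [ZMod.card]
  simp only [h2]
  rw [prod_ite, prod_const_one, one_mul, prod_const, filter_not, card_sdiff]
  simp

namespace KWiseUniform

variable {Ω A W : Type} [Fintype Ω] [Fintype A] [Fintype W] {n K : ℕ}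
  {X : Ω → A × W → Fin n → ZMod 2}

theorem card_exists_deviation_le (hX : KWiseUniform X (2 * K)) {s : ℕ} (hs : s ≤ n) {μ η : ℝ}
    (hμ : μ = Fintype.card W / 2 ^ s) (hμ1 : 1 ≤ μ) (hη : 0 < η) :
    ((numOf fun ω => ∃ c : A × Finset (Fin n) × (Fin n → ZMod 2), c.2.1.card = s ∧
      η * μ < |((numOf fun w => ∀ i ∈ c.2.1, X ω (c.1, w) i = c.2.2 i) : ℝ) - μ|)
        : ℝ)
      ≤ (Fintype.card A * 2 ^ n * 2 ^ n) *
        (Fintype.card Ω * ((K + 1) * (K : ℝ) ^ (2 * K)) / (η ^ (2 * K) * μ ^ K)) := by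
  have hpos : 0 < η ^ (2 * K) * μ ^ K := by positivity
  refine (card_filter_exists_le _ (c := Fintype.card Ω * ((K + 1) * (K : ℝ) ^ (2 * K))
    / (η ^ (2 * K) * μ ^ K)) ?_).trans (le_of_eq ?_)
  · rintro ⟨m, S, z⟩
    by_cases hS : S.card = s
    · simp only [hS, true_and]
      rw [le_div_iff₀ hpos]
      refine (hX.comp (fun w => (m, w)) (Prod.mk_right_injective m)).card_deviation_le
        (fun v => ∀ i ∈ S, v i = z i) (σ := (2 ^ s)⁻¹) ?_ hμ1 (by rw [hμ, div_eq_mul_inv]) hη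
      rw [card_agree_on, hS, card_vec]
      push_cast
      rw [pow_sub₀ _ (by norm_num) hs, mul_comm]
    · simp only [hS, false_and, numOf_false, Nat.cast_zero]
      positivity
  · rw [Fintype.card_prod, Fintype.card_prod, Fintype.card_finset, Fintype.card_fin]
    push_cast
    rw [card_vec]
    ring

theorem card_exists_crowded_ball_le (hX : KWiseUniform X (2 * K)) {t : ℕ} {B : ℝ}
    (hB : ∀ c, ((numOf fun v : Fin n → ZMod 2 => hammingDist v c ≤ t) : ℝ) ≤ B) :
    ((numOf fun ω => ∃ c : A × (Fin n → ZMod 2) × (Fin K → W),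
      Function.Injective c.2.2 ∧
        ∀ i, hammingDist (X ω (c.1, c.2.2 i)) c.2.1 ≤ t) : ℝ)
      ≤ (Fintype.card A * 2 ^ n * (Fintype.card W) ^ K) *
        (Fintype.card Ω * B ^ K / (2 ^ n) ^ K) := by
  have hB0 : 0 ≤ B := le_trans (Nat.cast_nonneg _) (hB 0)
  refine (card_filter_exists_le _ (c := Fintype.card Ω * B ^ K / (2 ^ n) ^ K) ?_).trans
    (le_of_eq ?_)
  · rintro ⟨m, c, f⟩
    by_cases hf : Function.Injective f
    · simp only [hf, true_and]
      rw [le_div_iff₀ (by positivity)]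
      have := hX.card_event (Fin K) (fun i => (m, f i))
        ((Prod.mk_right_injective m).comp hf) (by simp; omega)
        (fun y => ∀ i, hammingDist (y i) c ≤ t)
      rw [card_vec, Fintype.card_fin] at this
      rw [this]
      have hE : ((numOf fun y : Fin K → Fin n → ZMod 2 =>
          ∀ i, hammingDist (y i) c ≤ t) : ℝ) ≤ B ^ K := by
        have : (univ.filter fun y : Fin K → Fin n → ZMod 2 => ∀ i, hammingDist (y i) c ≤ t)
            = Fintype.piFinset fun _ => univ.filter fun v => hammingDist v c ≤ t := by
          ext y; simp
        rw [numOf_eq_card, this, Fintype.card_piFinset, prod_const, card_univ, Fintype.card_fin,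
          ← numOf_eq_card]
        push_cast
        exact pow_le_pow_left₀ (Nat.cast_nonneg _) (hB c) K
      refine mul_le_mul_of_nonneg_left (le_trans (le_of_eq ?_) hE) (Nat.cast_nonneg _)
      congr!
    · simp only [hf, false_and, numOf_false, Nat.cast_zero]
      positivity
  · rw [Fintype.card_prod, Fintype.card_prod, Fintype.card_fun (α := Fin K), Fintype.card_fin]
    push_cast
    rw [card_vec]
    ring

theorem card_confusable_pairs_le {t : ℕ} {B : ℝ}
    (hB : ∀ c, ((numOf fun v : Fin n → ZMod 2 => hammingDist v c ≤ t) : ℝ) ≤ B)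
    (S : Finset (Fin n)) (z e : Fin n → ZMod 2) :
    ((numOf fun y : Fin K ⊕ Fin K → Fin n → ZMod 2 => ∀ i,
      (∀ j ∈ S, y (Sum.inl i) j = z j) ∧
        hammingDist (y (Sum.inr i)) (y (Sum.inl i) + e) ≤ t) : ℝ)
      ≤ (2 ^ (n - S.card) * B) ^ K := by
  set D : Finset ((_ : Fin n → ZMod 2) × (Fin n → ZMod 2)) :=
    (univ.filter fun v : Fin n → ZMod 2 => ∀ j ∈ S, v j = z j).sigma
      fun v => univ.filter fun u => hammingDist u (v + e) ≤ t with hD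
  have hDc : (D.card : ℝ) ≤ 2 ^ (n - S.card) * B := by
    rw [hD, card_sigma]
    push_cast
    simp only [← numOf_eq_card]
    refine (sum_le_sum fun v _ => hB (v + e)).trans (le_of_eq ?_)
    rw [sum_const, nsmul_eq_mul, ← numOf_eq_card, card_agree_on]
    push_cast
    rfl
  have hle : (numOf fun y : Fin K ⊕ Fin K → Fin n → ZMod 2 => ∀ i,
      (∀ j ∈ S, y (Sum.inl i) j = z j) ∧
        hammingDist (y (Sum.inr i)) (y (Sum.inl i) + e) ≤ t)
      ≤ (Fintype.piFinset fun _ : Fin K => D).card := by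
    rw [numOf]
    refine card_le_card_of_injOn (fun y i => ⟨y (Sum.inl i), y (Sum.inr i)⟩) ?_ ?_
    · intro y hy
      simp only [coe_filter, mem_univ, true_and, Set.mem_ofPred_eq] at hy
      refine mem_coe.2 (Fintype.mem_piFinset.2 fun i => ?_)
      rw [hD]
      simpa using hy i
    · intro y _ y' _ h
      funext i
      rcases i with i | i
      · have := congrFun h i
        exact congrArg Sigma.fst this
      · have := congrFun h i
        simp only [Sigma.mk.injEq, heq_eq_eq] at this
        exact this.2
  rw [Fintype.card_piFinset, prod_const, card_univ, Fintype.card_fin] at hle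
  have hle' : ((numOf fun y : Fin K ⊕ Fin K → Fin n → ZMod 2 => ∀ i,
      (∀ j ∈ S, y (Sum.inl i) j = z j) ∧
        hammingDist (y (Sum.inr i)) (y (Sum.inl i) + e) ≤ t) : ℝ) ≤ (D.card : ℝ) ^ K := by
    exact_mod_cast hle
  exact hle'.trans (pow_le_pow_left₀ (Nat.cast_nonneg _) hDc K)

theorem card_exists_confusion_le (hX : KWiseUniform X (2 * K)) {s t : ℕ} {B : ℝ}
    (hB : ∀ c, ((numOf fun v : Fin n → ZMod 2 => hammingDist v c ≤ t) : ℝ) ≤ B) :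
    ((numOf fun ω => ∃ c : (A × Finset (Fin n)) × ((Fin n → ZMod 2) × (Fin n → ZMod 2)) ×
        ((Fin K → W) × (Fin K → A × W)),
      c.1.2.card = s ∧ Function.Injective c.2.2.1 ∧ Function.Injective c.2.2.2 ∧
        (∀ i, (c.2.2.2 i).1 ≠ c.1.1) ∧
        ∀ i, (∀ j ∈ c.1.2, X ω (c.1.1, c.2.2.1 i) j = c.2.1.1 j) ∧
          hammingDist (X ω (c.2.2.2 i)) (X ω (c.1.1, c.2.2.1 i) + c.2.1.2) ≤ t) : ℝ)
      ≤ (Fintype.card A * (2 ^ n) ^ 3 * (Fintype.card W ^ 2 * Fintype.card A) ^ K) *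
        (Fintype.card Ω * (2 ^ (n - s) * B) ^ K / (2 ^ n) ^ (2 * K)) := by
  have hB0 : 0 ≤ B := le_trans (Nat.cast_nonneg _) (hB 0)
  refine (card_filter_exists_le _
    (c := Fintype.card Ω * (2 ^ (n - s) * B) ^ K / (2 ^ n) ^ (2 * K)) ?_).trans (le_of_eq ?_)
  · rintro ⟨⟨m, S⟩, ⟨z, e⟩, f, u⟩
    by_cases hc : S.card = s ∧ Function.Injective f ∧ Function.Injective u ∧ ∀ i, (u i).1 ≠ m
    · obtain ⟨hS, hf, hu, hm⟩ := hc
      simp only [hS, hf, hu, hm, true_and, ne_eq, not_false_eq_true, implies_true]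
      rw [le_div_iff₀ (by positivity)]
      have := hX.card_event (Fin K ⊕ Fin K) (Sum.elim (fun i => (m, f i)) u)
        (((Prod.mk_right_injective m).comp hf).sumElim hu
          (fun i j h => hm j (congrArg Prod.fst h).symm)) (by simp; omega)
        (fun y => ∀ i, (∀ j ∈ S, y (Sum.inl i) j = z j) ∧
          hammingDist (y (Sum.inr i)) (y (Sum.inl i) + e) ≤ t)
      rw [card_vec, Fintype.card_sum, Fintype.card_fin, ← two_mul] at this
      simp only [Sum.elim_inl, Sum.elim_inr] at this
      rw [this]
      have h1 := card_confusable_pairs_le (K := K) hB S z e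
      rw [hS] at h1
      refine mul_le_mul_of_nonneg_left (le_trans (le_of_eq ?_) h1) (Nat.cast_nonneg _)
      congr!
    · have : ∀ ω, ¬ (S.card = s ∧ Function.Injective f ∧ Function.Injective u ∧
          (∀ i, (u i).1 ≠ m) ∧ ∀ i, (∀ j ∈ S, X ω (m, f i) j = z j) ∧
          hammingDist (X ω (u i)) (X ω (m, f i) + e) ≤ t) :=
        fun ω h => hc ⟨h.1, h.2.1, h.2.2.1, h.2.2.2.1⟩
      simp only [this, numOf_false, Nat.cast_zero]
      positivity
  · simp only [Fintype.card_prod, Fintype.card_fun, Fintype.card_finset, Fintype.card_fin]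
    have := card_vec n
    simp only [Fintype.card_fun, Fintype.card_fin] at this
    push_cast at this ⊢
    rw [this]
    ring

end KWiseUniform

theorem logb_two_ratio_le {η : ℝ} (hη0 : 0 < η) (hη : η ≤ 1 / 2) :
    Real.logb 2 ((1 + η) / (1 - η)) ≤ 8 * η := by
  have h1 : 0 < 1 - η := by linarith
  have h2 : (1 + η) / (1 - η) ≤ 1 + 4 * η := by
    rw [div_le_iff₀ h1]; nlinarith
  have h3 : Real.log ((1 + η) / (1 - η)) ≤ 4 * η := by
    have := Real.log_le_sub_one_of_pos (show 0 < (1 + η) / (1 - η) by positivity)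
    linarith
  have h4 := Real.log_two_gt_d9
  rw [Real.logb, div_le_iff₀ (by linarith)]
  nlinarith

theorem mutualInfo_mul_le {M Z : Type} [Fintype M] [Fintype Z] (PM : M → ℝ) (V : M → Z → ℝ)
    {q η : ℝ} (hq : 0 < q) (hη0 : 0 < η) (hη : η ≤ 1 / 2) (hPM : ∀ m, 0 ≤ PM m)
    (hPM1 : ∑ m, PM m = 1) (hV1 : ∀ m, ∑ z, V m z = 1)
    (hVl : ∀ m z, (1 - η) * q ≤ V m z) (hVu : ∀ m z, V m z ≤ (1 + η) * q) :
    mutualInfo (fun m z => PM m * V m z) ≤ 8 * η := by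
  have h1η : 0 < 1 - η := by linarith
  have hZ : ∀ z, (1 - η) * q ≤ ∑ m, PM m * V m z := by
    intro z
    calc (1 - η) * q = ∑ m, PM m * ((1 - η) * q) := by rw [← sum_mul, hPM1, one_mul]
      _ ≤ _ := sum_le_sum fun m _ => mul_le_mul_of_nonneg_left (hVl m z) (hPM m)
  have hterm : ∀ m z, PM m * V m z * Real.logb 2 (PM m * V m z /
      ((∑ z', PM m * V m z') * ∑ m', PM m' * V m' z)) ≤ PM m * V m z * (8 * η) := by
    intro m z
    rcases (hPM m).eq_or_lt with h | h
    · simp [← h]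
    have hV0 : 0 < V m z := lt_of_lt_of_le (by positivity) (hVl m z)
    have hZ0 : 0 < ∑ m', PM m' * V m' z := lt_of_lt_of_le (by positivity) (hZ z)
    refine mul_le_mul_of_nonneg_left (le_trans ?_ (logb_two_ratio_le hη0 hη)) (by positivity)
    rw [← mul_sum, hV1, mul_one, mul_div_mul_left _ _ h.ne']
    refine Real.logb_le_logb_of_le (by norm_num) (by positivity) ?_
    rw [div_le_div_iff₀ hZ0 h1η]
    calc V m z * (1 - η) ≤ (1 + η) * q * (1 - η) := by gcongr; exact hVu m z
      _ = (1 + η) * ((1 - η) * q) := by ring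
      _ ≤ _ := by gcongr; exact hZ z
  calc mutualInfo (fun m z => PM m * V m z)
      ≤ ∑ m, ∑ z, PM m * V m z * (8 * η) :=
        sum_le_sum fun m _ => sum_le_sum fun z _ => hterm m z
    _ = 8 * η := by
        simp_rw [← sum_mul, ← mul_sum, hV1, mul_one, hPM1, one_mul]

theorem semLeak_le {n s : ℕ} {M W : Type} [Fintype M] [Fintype W]
    (x : M → W → Fin n → ZMod 2) {μ η : ℝ} (hμ : μ = Fintype.card W / 2 ^ s) (hμ0 : 0 < μ)
    (hη0 : 0 < η) (hη : η ≤ 1 / 2)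
    (hx : ∀ m (S : Finset (Fin n)) (z : Fin n → ZMod 2), S.card = s →
      |((numOf fun w => ∀ i ∈ S, x m w i = z i) : ℝ) - μ| ≤ η * μ) :
    semLeak s x ≤ 8 * η := by
  refine Real.sSup_le ?_ (by positivity)
  rintro I ⟨PM, S, hPM, hPM1, hS, rfl⟩
  have hW : (0 : ℝ) < Fintype.card W := by
    rw [hμ] at hμ0
    by_contra h
    have : (Fintype.card W : ℝ) = 0 := le_antisymm (not_lt.1 h) (Nat.cast_nonneg _)
    simp [this] at hμ0
  have hq : μ / Fintype.card W = (2 ^ s)⁻¹ := by rw [hμ]; field_simp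
  have hcount : ∀ m (z : {i : Fin n // i ∈ S} → ZMod 2),
      |(((univ.filter fun w : W => (fun i : {i : Fin n // i ∈ S} => x m w i.val) = z).card : ℝ))
        - μ| ≤ η * μ := by
    intro m z
    have := hx m S (fun i => if h : i ∈ S then z ⟨i, h⟩ else 0) hS
    rw [numOf_eq_card] at this
    convert this using 6
    refine ⟨fun h i hi => ?_, fun h => funext fun i => ?_⟩
    · rw [← h]; simp [hi]
    · rw [h i.1 i.2]; simp
  refine mutualInfo_mul_le PM _ (q := (2 ^ s)⁻¹) (by positivity) hη0 hη hPM hPM1 ?_ ?_ ?_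
  · intro m
    rw [← sum_div, div_eq_one_iff_eq hW.ne', ← Nat.cast_sum, Nat.cast_inj,
      ← card_eq_sum_card_fiberwise (fun _ _ => mem_univ _), card_univ]
  · intro m z
    rw [← hq, ← mul_div_assoc]
    have := (abs_le.1 (hcount m z)).1
    gcongr
    linarith
  · intro m z
    rw [← hq, ← mul_div_assoc]
    have := (abs_le.1 (hcount m z)).2
    gcongr
    linarith

theorem exists_injective_of_le_card {α : Type} (T : Finset α) {K : ℕ} (h : K ≤ T.card) :
    ∃ f : Fin K → α, Function.Injective f ∧ ∀ i, f i ∈ T := by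
  obtain ⟨T', hT', hc⟩ := exists_subset_card_eq h
  refine ⟨fun i => ((T'.equivFinOfCardEq hc).symm i).1, fun i j hij => ?_, fun i => ?_⟩
  · exact (T'.equivFinOfCardEq hc).symm.injective (Subtype.ext hij)
  · exact hT' ((T'.equivFinOfCardEq hc).symm i).2

theorem hammingDist_add_right_self {n : ℕ} (v e : Fin n → ZMod 2) :
    hammingDist v (v + e) = hammingDist e 0 := by
  simp [hammingDist]

theorem hammingDist_add_eq_hammingDist_sub {n : ℕ} (u v e : Fin n → ZMod 2) :
    hammingDist u (v + e) = hammingDist v (u - e) := by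
  have : ∀ i, u i = v i + e i ↔ v i = u i - e i := fun i => by rw [eq_sub_iff_add_eq, eq_comm]
  simp [hammingDist, this]

theorem card_confused_le {n s t K : ℕ} {A W : Type} [Fintype A] [Fintype W]
    (x : A × W → Fin n → ZMod 2)
    (hball : ∀ (m : A) (c : Fin n → ZMod 2) (f : Fin K → W), Function.Injective f →
      ¬ ∀ i, hammingDist (x (m, f i)) c ≤ t)
    (hconf : ∀ (m : A) (S : Finset (Fin n)) (z e : Fin n → ZMod 2) (f : Fin K → W)
      (u : Fin K → A × W), S.card = s → Function.Injective f → Function.Injective u →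
      (∀ i, (u i).1 ≠ m) → ¬ ∀ i, (∀ j ∈ S, x (m, f i) j = z j) ∧
        hammingDist (x (u i)) (x (m, f i) + e) ≤ t)
    (m : A) (S : Finset (Fin n)) (hS : S.card = s)
    (e : ({i : Fin n // i ∈ S} → ZMod 2) → Fin n → ZMod 2) (he : ∀ z, hammingDist (e z) 0 ≤ t) :
    (univ.filter fun w : W => ∃ (m' : A) (w' : W), m' ≠ m ∧
        hammingDist (x (m', w')) (x (m, w) + e (fun i => x (m, w) i.val))
          ≤ hammingDist (x (m, w)) (x (m, w) + e (fun i => x (m, w) i.val))).card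
      ≤ K * K * 2 ^ s := by
  set bad := univ.filter fun w : W => ∃ (m' : A) (w' : W), m' ≠ m ∧
        hammingDist (x (m', w')) (x (m, w) + e (fun i => x (m, w) i.val))
          ≤ hammingDist (x (m, w)) (x (m, w) + e (fun i => x (m, w) i.val)) with hbad
  have hz : ∀ z ∈ (univ : Finset ({i : Fin n // i ∈ S} → ZMod 2)),
      (bad.filter fun w => (fun i : {i : Fin n // i ∈ S} => x (m, w) i.val) = z).card
        ≤ K * K := by
    intro z _
    set F := bad.filter fun w => (fun i : {i : Fin n // i ∈ S} => x (m, w) i.val) = z with hF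
    have hex : ∀ w : W, ∃ u : A × W, w ∈ F →
        u.1 ≠ m ∧ hammingDist (x u) (x (m, w) + e z) ≤ t := by
      intro w
      by_cases hw : w ∈ F
      · obtain ⟨hb, rfl⟩ := mem_filter.1 hw
        obtain ⟨m', w', hm, hd⟩ := (mem_filter.1 hb).2
        refine ⟨(m', w'), fun _ => ⟨hm, hd.trans ?_⟩⟩
        rw [hammingDist_add_right_self]
        exact he _
      · exact ⟨(m, w), fun h => absurd h hw⟩
    choose u hu using hex
    have himage : (F.image u).card ≤ K := by
      by_contra! hlt
      obtain ⟨g, hg, hgF⟩ := exists_injective_of_le_card _ hlt.le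
      choose f hf hfg using fun i => mem_image.1 (hgF i)
      have hgf : g = u ∘ f := funext fun i => (hfg i).symm
      refine hconf m S (fun i => if h : i ∈ S then z ⟨i, h⟩ else 0) (e z) f g hS
        (Function.Injective.of_comp (hgf ▸ hg)) hg (fun i => ?_) (fun i => ⟨fun j hj => ?_, ?_⟩)
      · rw [← hfg i]
        exact (hu _ (hf i)).1
      · have := (mem_filter.1 (hf i)).2
        rw [← this]
        simp [hj]
      · rw [← hfg i]
        exact (hu _ (hf i)).2
    refine (card_le_mul_card_image F K fun v _ => ?_).trans (Nat.mul_le_mul_left _ himage)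
    by_contra! hlt
    obtain ⟨f, hf, hfF⟩ := exists_injective_of_le_card _ hlt.le
    refine hball m (x v - e z) f hf fun i => ?_
    obtain ⟨hi, rfl⟩ := mem_filter.1 (hfF i)
    rw [← hammingDist_add_eq_hammingDist_sub]
    exact (hu _ hi).2
  calc bad.card ≤ (K * K) * (univ : Finset ({i : Fin n // i ∈ S} → ZMod 2)).card :=
        card_le_mul_card_image_of_maps_to (fun _ _ => mem_univ _) _ hz
    _ = _ := by rw [card_univ, Fintype.card_fun, ZMod.card, Fintype.card_coe, hS]

theorem numOf_pos {α : Type} [Fintype α] {P : α → Prop} {a : α} (h : P a) : 0 < numOf P :=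
  card_pos.2 ⟨a, mem_filter.2 ⟨mem_univ a, h⟩⟩

theorem exists_not_of_numOf_lt {Ω : Type} [Fintype Ω] (P₁ P₂ P₃ : Ω → Prop)
    (h : ((numOf P₁ : ℝ) + numOf P₂ + numOf P₃) < Fintype.card Ω) :
    ∃ ω, ¬ P₁ ω ∧ ¬ P₂ ω ∧ ¬ P₃ ω := by
  by_contra! hall
  have hsub : (univ : Finset Ω) ⊆ univ.filter P₁ ∪ univ.filter P₂ ∪ univ.filter P₃ := by
    intro ω _
    simp only [mem_union, mem_filter, mem_univ, true_and]
    have := hall ω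
    tauto
  have hle : Fintype.card Ω ≤ numOf P₁ + numOf P₂ + numOf P₃ := by
    refine (card_le_card hsub).trans ((card_union_le _ _).trans ?_)
    exact Nat.add_le_add_right (card_union_le _ _) _
  exact absurd h (not_lt.2 (by exact_mod_cast hle))

theorem two_pow_mul_le_of_exponent_le {K : ℕ} {x y d N : ℝ} (hN : 0 ≤ N) (hx : x ≤ 4 * N)
    (hy : y = -(d * N)) (hd : 5 ≤ K * d) :
    (2 : ℝ) ^ (x + K * y) ≤ 2 ^ (-N) := by
  refine Real.rpow_le_rpow_of_exponent_le (by norm_num) ?_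
  rw [hy]
  nlinarith [mul_le_mul_of_nonneg_right hd hN]

theorem KWiseUniform.exists_good {Ω : Type} [Fintype Ω] [Nonempty Ω] {n K a b s t : ℕ}
    {X : Ω → (Fin a → ZMod 2) × (Fin b → ZMod 2) → Fin n → ZMod 2}
    (hX : KWiseUniform X (2 * K)) {H ε d₂ d₃ η : ℝ} (hsn : s ≤ n) (han : a ≤ n)
    (hball : ∀ c, ((numOf fun v : Fin n → ZMod 2 => hammingDist v c ≤ t) : ℝ) ≤ 2 ^ (H * n))
    (hε : 0 ≤ ε) (hη : η = 2 ^ (-(ε * n / 4)))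
    (h₁ : (b : ℝ) - s = ε * n) (hd₁ : 5 ≤ K * (ε / 2))
    (h₂ : b + H * n - n = -(d₂ * n)) (hd₂ : 5 ≤ K * d₂)
    (h₃ : 2 * b + a - s - n + H * n = -(d₃ * n)) (hd₃ : 5 ≤ K * d₃)
    (hn : 3 * ((K + 1) * (K : ℝ) ^ (2 * K) + 1) < 2 ^ n) :
    ∃ ω, (∀ m (S : Finset (Fin n)) (z : Fin n → ZMod 2), S.card = s →
        |((numOf fun w => ∀ i ∈ S, X ω (m, w) i = z i) : ℝ) - 2 ^ b / 2 ^ s|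
          ≤ η * (2 ^ b / 2 ^ s)) ∧
      (∀ m (c : Fin n → ZMod 2) (f : Fin K → Fin b → ZMod 2), Function.Injective f →
        ¬ ∀ i, hammingDist (X ω (m, f i)) c ≤ t) ∧
      (∀ m (S : Finset (Fin n)) (z e : Fin n → ZMod 2) (f : Fin K → Fin b → ZMod 2)
        (u : Fin K → (Fin a → ZMod 2) × (Fin b → ZMod 2)), S.card = s →
        Function.Injective f → Function.Injective u → (∀ i, (u i).1 ≠ m) →
        ¬ ∀ i, (∀ j ∈ S, X ω (m, f i) j = z j) ∧
          hammingDist (X ω (u i)) (X ω (m, f i) + e) ≤ t) := by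
  have hN : (0 : ℝ) ≤ n := Nat.cast_nonneg n
  have haN : (a : ℝ) ≤ n := by exact_mod_cast han
  set C : ℝ := (K + 1) * (K : ℝ) ^ (2 * K) with hC
  have hC0 : 0 ≤ C := by positivity
  have hΩ : (0 : ℝ) < Fintype.card Ω := by exact_mod_cast Fintype.card_pos
  have hμ : (2 : ℝ) ^ b / 2 ^ s = 2 ^ (ε * n) := by
    rw [← h₁, Real.rpow_sub (by norm_num), Real.rpow_natCast, Real.rpow_natCast]
  have hμ1 : (1 : ℝ) ≤ 2 ^ b / 2 ^ s := by
    rw [hμ]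
    exact Real.one_le_rpow (by norm_num) (by positivity)
  have hη0 : 0 < η := by rw [hη]; positivity
  have e₁ := hX.card_exists_deviation_le hsn (μ := 2 ^ b / 2 ^ s) (by rw [card_vec]) hμ1 hη0
  have e₂ := hX.card_exists_crowded_ball_le hball
  have e₃ := hX.card_exists_confusion_le (s := s) hball
  have b₁ : (2 : ℝ) ^ a * 2 ^ n * 2 ^ n * (Fintype.card Ω * C /
      (η ^ (2 * K) * (2 ^ b / 2 ^ s) ^ K)) ≤ Fintype.card Ω * (C * 2 ^ (-(n : ℝ))) := by
    have : (2 : ℝ) ^ a * 2 ^ n * 2 ^ n / (η ^ (2 * K) * (2 ^ b / 2 ^ s) ^ K)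
        = 2 ^ ((a + n + n : ℝ) + K * (-(ε / 2 * n))) := by
      rw [hμ, hη]
      simp only [← Real.rpow_natCast, ← Real.rpow_mul (zero_le_two (α := ℝ)),
        ← Real.rpow_add (zero_lt_two (α := ℝ)), ← Real.rpow_sub (zero_lt_two (α := ℝ))]
      congr 1
      push_cast
      ring
    calc _ = Fintype.card Ω * (C *
          ((2 : ℝ) ^ a * 2 ^ n * 2 ^ n / (η ^ (2 * K) * (2 ^ b / 2 ^ s) ^ K))) := by ring
      _ ≤ _ := by
        rw [this]
        refine mul_le_mul_of_nonneg_left (mul_le_mul_of_nonneg_left ?_ hC0) hΩ.le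
        refine two_pow_mul_le_of_exponent_le hN ?_ rfl hd₁
        linarith
  have b₂ : (2 : ℝ) ^ a * 2 ^ n * (2 ^ b) ^ K * (Fintype.card Ω * (2 ^ (H * n)) ^ K / (2 ^ n) ^ K)
      ≤ Fintype.card Ω * 2 ^ (-(n : ℝ)) := by
    have : (2 : ℝ) ^ a * 2 ^ n * (2 ^ b) ^ K * (2 ^ (H * n)) ^ K / (2 ^ n) ^ K
        = 2 ^ ((a + n : ℝ) + K * (b + H * n - n)) := by
      simp only [← Real.rpow_natCast, ← Real.rpow_mul (zero_le_two (α := ℝ)),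
        ← Real.rpow_add (zero_lt_two (α := ℝ)), ← Real.rpow_sub (zero_lt_two (α := ℝ))]
      congr 1
      ring
    calc _ = Fintype.card Ω *
          ((2 : ℝ) ^ a * 2 ^ n * (2 ^ b) ^ K * (2 ^ (H * n)) ^ K / (2 ^ n) ^ K) := by ring
      _ ≤ _ := by
        rw [this]
        refine mul_le_mul_of_nonneg_left ?_ hΩ.le
        refine two_pow_mul_le_of_exponent_le hN ?_ h₂ hd₂
        linarith
  have b₃ : (2 : ℝ) ^ a * (2 ^ n) ^ 3 * ((2 ^ b) ^ 2 * 2 ^ a) ^ K *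
      (Fintype.card Ω * (2 ^ (n - s) * 2 ^ (H * n)) ^ K / (2 ^ n) ^ (2 * K))
      ≤ Fintype.card Ω * 2 ^ (-(n : ℝ)) := by
    have : (2 : ℝ) ^ a * (2 ^ n) ^ 3 * ((2 ^ b) ^ 2 * 2 ^ a) ^ K *
        (2 ^ (n - s) * 2 ^ (H * n)) ^ K / (2 ^ n) ^ (2 * K)
        = 2 ^ ((a + n * 3 : ℝ) + K * (2 * b + a - s - n + H * n)) := by
      simp only [← Real.rpow_natCast, ← Real.rpow_mul (zero_le_two (α := ℝ)),
        ← Real.rpow_add (zero_lt_two (α := ℝ)), ← Real.rpow_sub (zero_lt_two (α := ℝ))]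
      congr 1
      push_cast [Nat.cast_sub hsn]
      ring
    calc _ = Fintype.card Ω * ((2 : ℝ) ^ a * (2 ^ n) ^ 3 * ((2 ^ b) ^ 2 * 2 ^ a) ^ K *
        (2 ^ (n - s) * 2 ^ (H * n)) ^ K / (2 ^ n) ^ (2 * K)) := by ring
      _ ≤ _ := by
        rw [this]
        refine mul_le_mul_of_nonneg_left ?_ hΩ.le
        refine two_pow_mul_le_of_exponent_le hN ?_ h₃ hd₃
        linarith
  have hsum : Fintype.card Ω * (C * 2 ^ (-(n : ℝ))) + Fintype.card Ω * 2 ^ (-(n : ℝ))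
      + Fintype.card Ω * 2 ^ (-(n : ℝ)) < Fintype.card Ω := by
    have hpos : (0 : ℝ) < 2 ^ n := by positivity
    have : (C + 2) * (2 : ℝ) ^ (-(n : ℝ)) < 1 := by
      rw [Real.rpow_neg zero_le_two, Real.rpow_natCast, ← div_eq_mul_inv, div_lt_one hpos]
      linarith
    calc _ = Fintype.card Ω * ((C + 2) * (2 : ℝ) ^ (-(n : ℝ))) := by ring
      _ < Fintype.card Ω * 1 := by gcongr
      _ = _ := mul_one _
  simp only [card_vec] at e₁ e₂ e₃
  obtain ⟨ω, g₁, g₂, g₃⟩ := exists_not_of_numOf_lt _ _ _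
    (lt_of_le_of_lt (add_le_add (add_le_add (e₁.trans b₁) (e₂.trans b₂)) (e₃.trans b₃)) hsum)
  refine ⟨ω, fun m S z hS => ?_, fun m c f hf h => g₂ ⟨(m, c, f), hf, h⟩,
    fun m S z e f u hS hf hu hm h => g₃ ⟨((m, S), (z, e), f, u), hS, hf, hu, hm, h⟩⟩
  by_contra! hlt
  exact g₁ ⟨(m, S, z), hS, hlt⟩

/-- Theorem 2: pseudolinear codes achieve the best-known semantic-secrecy capacity lower
bound `1 − H₂(p) − r` of the `(p,r)`-AWTC II: for any `R < 1 − H₂(p) − r` there are a key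
rate `R' ≥ 0` and a constant `k` such that for all large `n` some `[n,Rn,R'n,k]`
pseudolinear code is both semantically secret (leakage `≤ 2^{−γn}`) and reliable (error
probability `≤ δ` for every message, read set of size `rn`, and adversarial error map of
Hamming weight `≤ pn`, under minimum-distance decoding). -/
theorem pseudolinear_achieve_secrecy_capacity_lower_bound
    (p r : ℝ) (hp0 : 0 ≤ p) (hp1 : p ≤ 1 / 2) (hr0 : 0 ≤ r) (hr1 : r ≤ 1)
    (hpos : 0 < 1 - H2 p - r)
    (R : ℝ) (hR : R < 1 - H2 p - r) :
    ∃ (R' : ℝ) (k : ℕ) (γ c : ℝ), 0 ≤ R' ∧ 0 < k ∧ 0 < γ ∧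
      ∀ δ : ℝ, 0 < δ → ∃ n₀ : ℕ, ∀ n : ℕ, n₀ ≤ n →
        ∀ a b s t : ℕ, (a : ℝ) = R * n → (b : ℝ) = R' * n →
          (s : ℝ) = r * n → (t : ℝ) = p * n →
        ∃ (ℓ : ℕ) (h : (Fin a → ZMod 2) × (Fin b → ZMod 2) → Fin ℓ → ZMod 2)
          (G : Matrix (Fin ℓ) (Fin n) (ZMod 2))
          (x : (Fin a → ZMod 2) → (Fin b → ZMod 2) → Fin n → ZMod 2),
          -- pseudolinear encoder
          (x = fun m w => Matrix.vecMul (h (m, w)) G) ∧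
          ((ℓ : ℝ) ≤ c * k * (R + R') * n) ∧
          -- images of distinct nonzero inputs are distinct nonzero vectors ...
          (∀ q, q ≠ 0 → h q ≠ 0) ∧
          (∀ q q', q ≠ 0 → q' ≠ 0 → q ≠ q' → h q ≠ h q') ∧
          -- ... any k of which are linearly independent over GF(2)
          (∀ T : Finset ((Fin a → ZMod 2) × (Fin b → ZMod 2)),
            0 ∉ T → T.card ≤ k →
            LinearIndependent (ZMod 2) (fun q : T => h q.val)) ∧
          -- (i) semantic secrecy
          semLeak s x ≤ (2 : ℝ) ^ (-(γ * n)) ∧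
          -- (ii) reliability under minimum-distance decoding
          (∀ m : Fin a → ZMod 2, ∀ S : Finset (Fin n), S.card = s →
            ∀ e : ({i : Fin n // i ∈ S} → ZMod 2) → Fin n → ZMod 2,
              (∀ z, hammingDist (e z) 0 ≤ t) →
              ((Finset.univ.filter (fun w : Fin b → ZMod 2 =>
                  ∃ (m' : Fin a → ZMod 2) (w' : Fin b → ZMod 2), m' ≠ m ∧
                    hammingDist (x m' w')
                        (x m w + e (fun i : {i : Fin n // i ∈ S} => x m w i.val))
                      ≤ hammingDist (x m w)
                        (x m w + e (fun i : {i : Fin n // i ∈ S} => x m w i.val)))).card : ℝ)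
                / (2 : ℝ) ^ b ≤ δ) := by
  set Δ : ℝ := 1 - H2 p - r - R with hΔ
  have hΔ0 : 0 < Δ := by linarith
  obtain ⟨R', hrR', hR'⟩ := exists_rat_btwn
    (show r < min (r + Δ / 2) (1 - H2 p) from lt_min (by linarith) (by linarith))
  obtain ⟨hR'₁, hR'₂⟩ := lt_min_iff.1 hR'
  set ε : ℝ := R' - r with hε
  set d₂ : ℝ := 1 - H2 p - R' with hd₂
  set d₃ : ℝ := Δ - 2 * ε with hd₃
  have hε0 : 0 < ε := by linarith
  have hν : 0 < min (ε / 2) (min d₂ d₃) :=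
    lt_min (by linarith) (lt_min (by linarith) (by linarith))
  obtain ⟨K, hK⟩ := exists_nat_ge (5 / min (ε / 2) (min d₂ d₃))
  rw [div_le_iff₀ hν] at hK
  have hKpos : 0 < K := by
    rcases Nat.eq_zero_or_pos K with h | h
    · simp [h] at hK
      linarith
    · exact h
  have hK0 : (0 : ℝ) ≤ K := Nat.cast_nonneg K
  have hKε : 5 ≤ K * (ε / 2) := hK.trans (mul_le_mul_of_nonneg_left (min_le_left _ _) hK0)
  have hKd₂ : 5 ≤ K * d₂ := hK.trans
    (mul_le_mul_of_nonneg_left ((min_le_right _ _).trans (min_le_left _ _)) hK0)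
  have hKd₃ : 5 ≤ K * d₃ := hK.trans
    (mul_le_mul_of_nonneg_left ((min_le_right _ _).trans (min_le_right _ _)) hK0)
  refine ⟨R', 2 * K, ε / 8, 3, by linarith, by omega, by linarith, fun δ hδ => ?_⟩
  set θ : ℝ := 2 ^ (-(ε / 8)) with hθ
  have hθ0 : 0 < θ := by positivity
  have hθ1 : θ < 1 := Real.rpow_lt_one_of_one_lt_of_neg (by norm_num) (by linarith)
  have ev₁ := (tendsto_pow_atTop_nhds_zero_of_lt_one hθ0.le hθ1).eventually_lt_const
    (show 0 < min (1 / 8) (δ / (K * K)) by positivity)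
  have ev₂ := (tendsto_pow_atTop_atTop_of_one_lt (one_lt_two (α := ℝ))).eventually_gt_atTop
    (3 * ((K + 1) * (K : ℝ) ^ (2 * K) + 1))
  obtain ⟨n₀, hn₀⟩ := Filter.eventually_atTop.1
    ((ev₁.and ev₂).and (Filter.eventually_ge_atTop 1))
  refine ⟨n₀, fun n hn a b s t ha hb hs ht => ?_⟩
  obtain ⟨⟨hn₁, hn₂⟩, hn1⟩ := hn₀ n hn
  obtain ⟨hn₃, hn₄⟩ := lt_min_iff.1 hn₁
  have hNpos : (0 : ℝ) < n := by exact_mod_cast hn1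
  have hsn : s ≤ n := by
    have : (s : ℝ) ≤ n := by
      rw [hs]
      exact mul_le_of_le_one_left hNpos.le hr1
    exact_mod_cast this
  have hball := card_hammingBall_le hp0 hp1 ht
  have hH : 0 ≤ H2 p * n := by
    by_contra! hlt
    have h1 := hball 0
    have h2 : 1 ≤ numOf fun v : Fin n → ZMod 2 => hammingDist v 0 ≤ t :=
      numOf_pos (a := 0) (by rw [hammingDist_self]; exact Nat.zero_le t)
    have h3 : (2 : ℝ) ^ (H2 p * n) < 1 :=
      Real.rpow_lt_one_of_one_lt_of_neg (by norm_num) hlt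
    have h4 : (1 : ℝ) ≤ _ := (Nat.one_le_cast (α := ℝ)).2 h2
    linarith
  have han : a ≤ n := by
    have : (a : ℝ) ≤ n := by
      rw [ha]
      linarith [mul_lt_mul_of_pos_right hR hNpos, mul_nonneg hr0 hNpos.le]
    exact_mod_cast this
  have hab : 1 ≤ a + b := by
    have : (0 : ℝ) < b := by
      rw [hb]
      exact mul_pos (by linarith) hNpos
    have : 0 < b := by exact_mod_cast this
    omega
  have hbs : (b : ℝ) - s = ε * n := by rw [hb, hs]; ring
  have hθn : θ ^ n = 2 ^ (-(ε / 8 * n)) := by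
    rw [hθ, ← Real.rpow_natCast, ← Real.rpow_mul zero_le_two, neg_mul]
  obtain ⟨h, hh⟩ := exists_linearIndependent_of_card_le
    ((Fin a → ZMod 2) × (Fin b → ZMod 2)) (2 * K) ((a + b + 1) * (2 * K) + 1) (by
      have : Fintype.card ((Fin a → ZMod 2) × (Fin b → ZMod 2)) + 1 ≤ 2 ^ (a + b + 1) := by
        simp only [Fintype.card_prod, Fintype.card_fun, ZMod.card, Fintype.card_fin, ← pow_add]
        have := Nat.one_le_two_pow (n := a + b)
        rw [pow_succ]
        omega
      calc _ ≤ (2 ^ (a + b + 1)) ^ (2 * K) := Nat.pow_le_pow_left this _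
        _ = 2 ^ ((a + b + 1) * (2 * K)) := (pow_mul _ _ _).symm
        _ < _ := Nat.pow_lt_pow_right (by norm_num) (Nat.lt_succ_self _))
  obtain ⟨G, hG₁, hG₂, hG₃⟩ := (kWiseUniform_vecMul (n := n) h hh).exists_good (H := H2 p)
    (ε := ε) (d₂ := d₂) (d₃ := d₃) (η := 2 ^ (-(ε * n / 4))) hsn han hball hε0.le rfl hbs hKε
    (by rw [hb]; ring) hKd₂ (by rw [ha, hb, hs]; ring) hKd₃ hn₂
  have hη : (2 : ℝ) ^ (-(ε * n / 4)) = θ ^ n * θ ^ n := by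
    rw [hθn, ← Real.rpow_add zero_lt_two]
    congr 1
    ring
  have hθn0 : 0 < θ ^ n := pow_pos hθ0 n
  have h8 : 8 * (2 : ℝ) ^ (-(ε * n / 4)) ≤ θ ^ n := by
    rw [hη]
    linarith [mul_le_mul_of_nonneg_left hn₃.le hθn0.le]
  refine ⟨(a + b + 1) * (2 * K) + 1, h, G, fun m w => Matrix.vecMul (h (m, w)) G, rfl, ?_, ?_, ?_,
    fun T _ hT => hh T hT, ?_, ?_⟩
  · have h1 : (a + b + 1) * (2 * K) + 1 ≤ 3 * (2 * K) * (a + b) := by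
      linarith [Nat.le_mul_of_pos_right K hab]
    calc (((a + b + 1) * (2 * K) + 1 : ℕ) : ℝ) ≤ ((3 * (2 * K) * (a + b) : ℕ) : ℝ) :=
          Nat.cast_le.2 h1
      _ = _ := by push_cast; rw [ha, hb]; ring
  · intro q _
    exact (hh {q} (by simp; omega)).ne_zero ⟨q, mem_singleton_self q⟩
  · intro q q' _ _ hqq' heq
    have := (hh {q, q'} ((card_le_two).trans (by omega))).injective
      (a₁ := ⟨q, by simp⟩) (a₂ := ⟨q', by simp⟩) heq
    exact hqq' (congrArg Subtype.val this)
  · rw [← hθn]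
    refine le_trans (semLeak_le _ (μ := 2 ^ b / 2 ^ s) (by rw [card_vec]) (by positivity)
      (by positivity) (by linarith) hG₁) h8
  · intro m S hS e he
    have hc := card_confused_le (fun q => Matrix.vecMul (h q) G) hG₂ hG₃ m S hS e he
    have hsb : (2 : ℝ) ^ s / 2 ^ b ≤ θ ^ n := by
      rw [hθn, ← Real.rpow_natCast, ← Real.rpow_natCast, ← Real.rpow_sub zero_lt_two]
      refine Real.rpow_le_rpow_of_exponent_le one_le_two ?_
      have : 0 ≤ ε * n := by positivity
      linarith
    have hδ' : K * K * ((2 : ℝ) ^ s / 2 ^ b) ≤ δ := by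
      have hKK : (0 : ℝ) < K * K := by positivity
      rw [lt_div_iff₀ hKK] at hn₄
      exact (mul_le_mul_of_nonneg_left hsb hKK.le).trans (by linarith)
    refine le_trans (le_trans (div_le_div_of_nonneg_right
      (Nat.cast_le.2 (le_trans (le_of_eq ?_) hc)) (by positivity)) (le_of_eq ?_)) hδ'
    · congr!
    · push_cast
      ring
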